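/- arXiv:2410.15009 — 5 statements merged into one kernel-verified Lean document; each statement's English description precedes it below -/
import Mathlib

section
/- Under the strong convexity, Lipschitz-gradient, and smoothness-bound assumptions, for any sampling times t_k ≥ 0 and t_{k+1} = t_k + δ with δ > 0, the optimal values of the time-varying problem satisfy |f*(t_{k+1}) − f*(t_k)| ≤ ψ, where ψ = δ(K₁ + (δ/2)K₃) + (K₂²δ²/(2m))((Mδ/m) + 2). -/
open scoped RealInnerProductSpace

noncomputable def gradX {n : ℕ} (f : EuclideanSpace ℝ (Fin n) → ℝ → ℝ)
    (x : EuclideanSpace ℝ (Fin n)) (t : ℝ) : EuclideanSpace ℝ (Fin n) :=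
  gradient (fun y => f y t) x

noncomputable def gradT {n : ℕ} (f : EuclideanSpace ℝ (Fin n) → ℝ → ℝ)
    (x : EuclideanSpace ℝ (Fin n)) (t : ℝ) : ℝ :=
  deriv (fun s => f x s) t

noncomputable def gradXT {n : ℕ} (f : EuclideanSpace ℝ (Fin n) → ℝ → ℝ)
    (x : EuclideanSpace ℝ (Fin n)) (t : ℝ) : EuclideanSpace ℝ (Fin n) :=
  gradient (fun y => deriv (fun s => f y s) t) x

noncomputable def gradTT {n : ℕ} (f : EuclideanSpace ℝ (Fin n) → ℝ → ℝ)
    (x : EuclideanSpace ℝ (Fin n)) (t : ℝ) : ℝ :=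
  deriv (fun s => deriv (fun r => f x r) s) t

/-- The mean value inequality in the time variable. -/
theorem abs_sub_le_of_abs_gradT_le {n : ℕ} {f : EuclideanSpace ℝ (Fin n) → ℝ → ℝ} {K : ℝ}
    (hf : Differentiable ℝ (Function.uncurry f)) (x : EuclideanSpace ℝ (Fin n))
    (hK : ∀ t : ℝ, 0 ≤ t → |gradT f x t| ≤ K) {s t : ℝ} (hs : 0 ≤ s) (ht : 0 ≤ t) :
    |f x t - f x s| ≤ K * |t - s| := by
  have hd : Differentiable ℝ (fun r => f x r) :=
    hf.comp ((differentiable_const x).prodMk differentiable_id)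
  exact (convex_Ici (0 : ℝ)).norm_image_sub_le_of_norm_deriv_le
    (fun r _ => hd r) (fun r hr => hK r hr) hs ht

/-- The difference of two minimum values is at most any uniform bound on the difference
of the functions. -/
theorem abs_sub_le_of_forall_min {α : Type*} {g h : α → ℝ} {a b : α} {C : ℝ}
    (ha : ∀ y, g a ≤ g y) (hb : ∀ y, h b ≤ h y) (hC : ∀ y, |h y - g y| ≤ C) :
    |h b - g a| ≤ C :=
  abs_le.mpr ⟨by linarith [(abs_le.mp (hC b)).1, ha b], by linarith [(abs_le.mp (hC a)).2, hb a]⟩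

/-- Lemma 1 (Bound on the cost difference of the optimizer): under strong convexity,
Lipschitz gradient and smoothness bounds, `|f*(t_{k+1}) - f*(t_k)| ≤ ψ`. -/
theorem stmt_0 {n : ℕ} (hn : 1 ≤ n)
    (f : EuclideanSpace ℝ (Fin n) → ℝ → ℝ)
    (m M K₁ K₂ K₃ : ℝ) (hm : 0 < m) (hM : 0 < M)
    (hK₁ : 0 < K₁) (hK₂ : 0 < K₂) (hK₃ : 0 < K₃)
    (hC2 : ContDiff ℝ 2 (Function.uncurry f))
    (hsc : ∀ t : ℝ, 0 ≤ t → ∀ x z : EuclideanSpace ℝ (Fin n), x ≠ z →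
      m * ‖z - x‖ ^ 2 ≤ ⟪z - x, gradX f z t - gradX f x t⟫)
    (hlip : ∀ t : ℝ, 0 ≤ t → ∀ x z : EuclideanSpace ℝ (Fin n), x ≠ z →
      ⟪z - x, gradX f z t - gradX f x t⟫ ≤ M * ‖z - x‖ ^ 2)
    (hb1 : ∀ (x : EuclideanSpace ℝ (Fin n)) (t : ℝ), 0 ≤ t → |gradT f x t| ≤ K₁)
    (hb2 : ∀ (x : EuclideanSpace ℝ (Fin n)) (t : ℝ), 0 ≤ t → ‖gradXT f x t‖ ≤ K₂)
    (hb3 : ∀ (x : EuclideanSpace ℝ (Fin n)) (t : ℝ), 0 ≤ t → |gradTT f x t| ≤ K₃)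
    (xstar : ℝ → EuclideanSpace ℝ (Fin n))
    (hmin : ∀ t : ℝ, 0 ≤ t → ∀ y, f (xstar t) t ≤ f y t)
    (tk δ : ℝ) (htk : 0 ≤ tk) (hδ : 0 < δ) :
    |f (xstar (tk + δ)) (tk + δ) - f (xstar tk) tk| ≤
      δ * (K₁ + (δ / 2) * K₃) + (K₂ ^ 2 * δ ^ 2 / (2 * m)) * ((M * δ / m) + 2) := by
  have hf : Differentiable ℝ (Function.uncurry f) := hC2.differentiable (by norm_num)
  have hopt : |f (xstar (tk + δ)) (tk + δ) - f (xstar tk) tk| ≤ K₁ * δ := by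
    refine abs_sub_le_of_forall_min (g := fun y => f y tk) (h := fun y => f y (tk + δ))
      (hmin tk htk) (hmin (tk + δ) (by positivity)) fun y => ?_
    simpa [abs_of_pos hδ] using
      abs_sub_le_of_abs_gradT_le hf y (hb1 y) htk (add_nonneg htk hδ.le)
  have hK₃δ : 0 ≤ δ * (δ / 2 * K₃) := by positivity
  have hrest : 0 ≤ K₂ ^ 2 * δ ^ 2 / (2 * m) * (M * δ / m + 2) := by positivity
  linarith
end

section
/- Under the Lipschitz-gradient and smoothness-bound assumptions, fix x_k ∈ ℝⁿ, t_k ≥ 0, ε > 0, and a stepsize δ with 0 < δ ≤ 2ε²/(K₁M + 2εK₂). Define the predicted point p: if ‖∇ₓf(x_k,t_k)‖ ≥ ε, set p = x_k − δ(|∇_t f(x_k,t_k)| / ‖∇ₓf(x_k,t_k)‖²) ∇ₓf(x_k,t_k); otherwise set p = x_k. Then f(p, t_k+δ) ≤ f(x_k, t_k+δ); that is, the prediction step of Algorithm 1 yields a function value at time t_{k+1} = t_k + δ no larger than that of the plain gradient-descent prediction p = x_k. -/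
open scoped RealInnerProductSpace

theorem le_quadratic_of_inner_gradient_sub_le {E : Type*} [NormedAddCommGroup E]
    [InnerProductSpace ℝ E] [CompleteSpace E] {φ : E → ℝ} {M : ℝ} (hφ : Differentiable ℝ φ)
    (h : ∀ x z : E, x ≠ z → ⟪z - x, gradient φ z - gradient φ x⟫ ≤ M * ‖z - x‖ ^ 2)
    (x v : E) : φ (x + v) ≤ φ x + ⟪gradient φ x, v⟫ + M / 2 * ‖v‖ ^ 2 := by
  rcases eq_or_ne v 0 with rfl | hv
  · simp
  have hderiv : ∀ s : ℝ, HasDerivAt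
      (fun s : ℝ => φ (x + s • v) - s * ⟪gradient φ x, v⟫ - s ^ 2 * (M / 2 * ‖v‖ ^ 2))
      (⟪gradient φ (x + s • v), v⟫ - ⟪gradient φ x, v⟫ - s * (M * ‖v‖ ^ 2)) s := by
    intro s
    have hline : HasDerivAt (fun s : ℝ => x + s • v) v s := by
      simpa using ((hasDerivAt_id s).smul_const v).const_add x
    have hcomp := (hφ (x + s • v)).hasGradientAt.hasFDerivAt.comp_hasDerivAt s hline
    have hlin := (hasDerivAt_id s).mul_const ⟪gradient φ x, v⟫
    have hquad := ((hasDerivAt_id s).pow 2).mul_const (M / 2 * ‖v‖ ^ 2)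
    refine ((hcomp.sub hlin).sub hquad).congr_deriv ?_
    simp
    ring
  have hanti := antitoneOn_of_deriv_nonpos (convex_Icc (0 : ℝ) 1)
    (fun s _ => (hderiv s).continuousAt.continuousWithinAt)
    (fun s _ => (hderiv s).differentiableAt.differentiableWithinAt) (by
      intro s hs
      rw [interior_Icc] at hs
      have hs0 : 0 < s := hs.1
      rw [(hderiv s).deriv]
      have key := h x (x + s • v) (by simp [hs0.ne', hv])
      rw [add_sub_cancel_left, norm_smul, real_inner_smul_left, real_inner_comm, inner_sub_left,
        Real.norm_eq_abs, mul_pow, sq_abs] at key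
      have : s * (⟪gradient φ (x + s • v), v⟫ - ⟪gradient φ x, v⟫ - s * (M * ‖v‖ ^ 2)) ≤ 0 := by
        linarith
      exact nonpos_of_mul_nonpos_right this hs0)
  have := hanti (Set.left_mem_Icc.2 zero_le_one) (Set.right_mem_Icc.2 zero_le_one) zero_le_one
  simp only [one_smul, zero_smul, add_zero, one_mul, zero_mul, one_pow, sub_zero, ne_eq,
    OfNat.ofNat_ne_zero, not_false_eq_true, zero_pow] at this
  linarith

theorem abs_sub_le_of_norm_gradient_le {E : Type*} [NormedAddCommGroup E]
    [InnerProductSpace ℝ E] [CompleteSpace E] {φ : E → ℝ} {K : ℝ} (hφ : Differentiable ℝ φ)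
    (h : ∀ x, ‖gradient φ x‖ ≤ K) (x y : E) : |φ y - φ x| ≤ K * ‖y - x‖ := by
  have := convex_univ.norm_image_sub_le_of_norm_fderiv_le (𝕜 := ℝ) (f := φ) (C := K)
    (fun z _ => hφ z) (fun z _ => by
      simpa [gradient] using h z) (Set.mem_univ x) (Set.mem_univ y)
  simpa using this

theorem ContDiff.differentiable_deriv_snd {E : Type*} [NormedAddCommGroup E] [NormedSpace ℝ E]
    {f : E → ℝ → ℝ} (hf : ContDiff ℝ 2 (Function.uncurry f)) (t : ℝ) :
    Differentiable ℝ (fun y => deriv (fun s => f y s) t) := by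
  have heq : (fun y => deriv (fun s => f y s) t) =
      fun y => fderiv ℝ (Function.uncurry f) (y, t) (0, 1) := by
    funext y
    have hpath : HasDerivAt (fun s : ℝ => (y, s)) ((0 : E), (1 : ℝ)) t :=
      (hasDerivAt_const t y).prodMk (hasDerivAt_id t)
    exact ((hf.differentiable (by norm_num) (y, t)).hasFDerivAt.comp_hasDerivAt t hpath).deriv
  rw [heq]
  have hd : Differentiable ℝ (fderiv ℝ (Function.uncurry f)) :=
    (hf.fderiv_right (m := 1) (by norm_num)).differentiable (by norm_num)
  fun_prop

/-- Lemma 2 (Function reduction due to Algorithm 1's prediction step): for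
`0 < δ ≤ 2ε²/(K₁M + 2εK₂)`, the prediction step of Algorithm 1 yields
`f(p, t_k+δ) ≤ f(x_k, t_k+δ)`. -/
theorem stmt_2 {n : ℕ} (hn : 1 ≤ n)
    (f : EuclideanSpace ℝ (Fin n) → ℝ → ℝ)
    (M K₁ K₂ K₃ : ℝ) (hM : 0 < M)
    (hK₁ : 0 < K₁) (hK₂ : 0 < K₂) (hK₃ : 0 < K₃)
    (hC2 : ContDiff ℝ 2 (Function.uncurry f))
    (hlip : ∀ t : ℝ, 0 ≤ t → ∀ x z : EuclideanSpace ℝ (Fin n), x ≠ z →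
      ⟪z - x, gradX f z t - gradX f x t⟫ ≤ M * ‖z - x‖ ^ 2)
    (hb1 : ∀ (x : EuclideanSpace ℝ (Fin n)) (t : ℝ), 0 ≤ t → |gradT f x t| ≤ K₁)
    (hb2 : ∀ (x : EuclideanSpace ℝ (Fin n)) (t : ℝ), 0 ≤ t → ‖gradXT f x t‖ ≤ K₂)
    (hb3 : ∀ (x : EuclideanSpace ℝ (Fin n)) (t : ℝ), 0 ≤ t → |gradTT f x t| ≤ K₃)
    (xk : EuclideanSpace ℝ (Fin n)) (tk δ ε : ℝ) (htk : 0 ≤ tk) (hε : 0 < ε)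
    (hδ : 0 < δ) (hδ2 : δ ≤ 2 * ε ^ 2 / (K₁ * M + 2 * ε * K₂))
    (p : EuclideanSpace ℝ (Fin n))
    (hp : p = if ε ≤ ‖gradX f xk tk‖ then
        xk - (δ * |gradT f xk tk| / ‖gradX f xk tk‖ ^ 2) • gradX f xk tk
      else xk) :
    f p (tk + δ) ≤ f xk (tk + δ) := by
  have hFd : Differentiable ℝ (Function.uncurry f) := hC2.differentiable (by norm_num)
  have hfx : Differentiable ℝ (fun y => f y tk) :=
    hFd.comp (differentiable_id.prodMk (differentiable_const tk))
  have hft : ∀ y, Differentiable ℝ (fun s => f y s) := fun y =>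
    hFd.comp ((differentiable_const y).prodMk differentiable_id)
  split_ifs at hp with hg
  swap
  · rw [hp]
  have hspace := le_quadratic_of_inner_gradient_sub_le hfx (hlip tk htk) xk (p - xk)
  have htime : f p (tk + δ) - f xk (tk + δ) - (f p tk - f xk tk) ≤ K₂ * ‖p - xk‖ * δ := by
    have hdiff : Differentiable ℝ (fun s => f p s - f xk s) := (hft p).sub (hft xk)
    have := (convex_Icc tk (tk + δ)).norm_image_sub_le_of_norm_deriv_le (𝕜 := ℝ)
      (f := fun s => f p s - f xk s) (C := K₂ * ‖p - xk‖) (fun s _ => hdiff s)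
      (fun s hs => by
        rw [deriv_fun_sub (hft p s) (hft xk s)]
        exact abs_sub_le_of_norm_gradient_le (hC2.differentiable_deriv_snd s)
          (fun y => hb2 y s (htk.trans hs.1)) xk p)
      (Set.left_mem_Icc.2 (by linarith)) (Set.right_mem_Icc.2 (by linarith))
    simp only [Real.norm_eq_abs, add_sub_cancel_left, abs_of_pos hδ] at this
    exact (le_abs_self _).trans this
  change _ ≤ _ + ⟪gradX f xk tk, p - xk⟫ + _ at hspace
  have ha := hb1 xk tk htk
  have ha0 := abs_nonneg (gradT f xk tk)
  set a := |gradT f xk tk|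
  set g := gradX f xk tk
  have hG : 0 < ‖g‖ := hε.trans_le hg
  have hpx : p - xk = -((δ * a / ‖g‖ ^ 2) • g) := by rw [hp]; abel
  have hnorm : ‖p - xk‖ = δ * a / ‖g‖ := by
    rw [hpx, norm_neg, norm_smul, Real.norm_of_nonneg (by positivity)]
    field_simp
  have hinner : ⟪g, p - xk⟫ = -(δ * a) := by
    rw [hpx, inner_neg_right, real_inner_smul_right, real_inner_self_eq_norm_sq]
    field_simp
  rw [hinner, hnorm, add_sub_cancel] at hspace
  rw [hnorm] at htime
  have hstep : δ * (M * a / (2 * ‖g‖ ^ 2) + K₂ / ‖g‖) ≤ 1 := by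
    calc δ * (M * a / (2 * ‖g‖ ^ 2) + K₂ / ‖g‖)
        ≤ δ * (M * K₁ / (2 * ε ^ 2) + K₂ / ε) := by gcongr
      _ = δ * (K₁ * M + 2 * ε * K₂) / (2 * ε ^ 2) := by field_simp
      _ ≤ 1 := by
        rw [div_le_one (by positivity)]
        exact (le_div_iff₀ (by positivity)).1 hδ2
  have hfinal := mul_le_mul_of_nonneg_left hstep (mul_nonneg hδ.le ha0)
  have hexpand : δ * a * (δ * (M * a / (2 * ‖g‖ ^ 2) + K₂ / ‖g‖)) =
      M / 2 * (δ * a / ‖g‖) ^ 2 + K₂ * (δ * a / ‖g‖) * δ := by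
    field_simp
  linarith
end

section
/- Under the strong convexity, Lipschitz-gradient, and smoothness-bound assumptions, let the sequence (x_k) be generated by Algorithm 1 with sampling period δ > 0, threshold ε > 0, and stepsize α satisfying 0 < α ≤ 1/(2M). Then for every k ≥ 0, f(x_k, t_k) − f*(t_k) ≤ (1 − 2καm)^k (f(x₀, t₀) − f*(t₀)) + (1 − (1 − 2καm)^k) E₁, where κ = 1 − αM/2, E₁ = ψ/(4κ²α²m) + max(γδ², μδ)/(4κ²α²m²), ψ = δ(K₁ + (δ/2)K₃) + (K₂²δ²/(2m))((Mδ/m) + 2), γ = 2K₁/δ + (M/(2ε²))K₁² + (1/2)K₃ + (1/ε)K₁K₂, and μ = K₁ + (δ/2)K₃. -/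
open scoped RealInnerProductSpace

section SmoothStronglyConvex

variable {E : Type*} [NormedAddCommGroup E] [InnerProductSpace ℝ E] [CompleteSpace E]

/-- One-sided quadratic upper bound from a one-sided Lipschitz condition on the gradient.
The constant may be negative, which gives the lower bound of strong convexity. -/
theorem le_quadratic_of_inner_gradient_sub_le_s3 {g : E → ℝ} {g' : E → E} {L : ℝ}
    (hg : ∀ x, HasGradientAt g (g' x) x)
    (hL : ∀ x z, x ≠ z → ⟪z - x, g' z - g' x⟫ ≤ L * ‖z - x‖ ^ 2) (x z : E) :
    g z ≤ g x + ⟪g' x, z - x⟫ + L / 2 * ‖z - x‖ ^ 2 := by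
  set v := z - x with hv
  let φ : ℝ → ℝ := fun s => g (x + s • v) - s * ⟪g' x, v⟫ - L / 2 * s ^ 2 * ‖v‖ ^ 2
  have hφ (s : ℝ) :
      HasDerivAt φ (⟪g' (x + s • v), v⟫ - ⟪g' x, v⟫ - L * s * ‖v‖ ^ 2) s := by
    have hline : HasDerivAt (fun s : ℝ => x + s • v) v s := by
      simpa using ((hasDerivAt_id s).smul_const v).const_add x
    have hcomp := (hg (x + s • v)).hasFDerivAt.comp_hasDerivAt s hline
    have hlin := (hasDerivAt_id s).mul_const ⟪g' x, v⟫
    have hsq := (((hasDerivAt_id s).pow 2).const_mul (L / 2)).mul_const (‖v‖ ^ 2)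
    refine ((hcomp.sub hlin).sub hsq).congr_deriv ?_
    simp
    exact Or.inl (by ring)
  have hanti : AntitoneOn φ (Set.Icc 0 1) := by
    refine antitoneOn_of_deriv_nonpos (convex_Icc 0 1)
      (fun s _ => (hφ s).continuousAt.continuousWithinAt)
      (fun s _ => (hφ s).differentiableAt.differentiableWithinAt) fun s hs => ?_
    rw [interior_Icc] at hs
    rw [(hφ s).deriv]
    rcases eq_or_ne v 0 with h0 | h0
    · simp [h0]
    have h := hL x (x + s • v) (by simp [h0, hs.1.ne'])
    rw [add_sub_cancel_left, real_inner_smul_left, norm_smul, mul_pow, Real.norm_eq_abs, sq_abs,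
      real_inner_comm, inner_sub_left] at h
    refine le_of_mul_le_mul_left ?_ hs.1
    linarith
  have h01 := hanti (Set.left_mem_Icc.2 zero_le_one) (Set.right_mem_Icc.2 zero_le_one) zero_le_one
  simp only [φ, one_smul, zero_smul, add_zero, hv, add_sub_cancel] at h01
  linarith

/-- The Polyak–Łojasiewicz inequality for strongly convex functions. -/
theorem sub_le_norm_sq_gradient_of_strongly_monotone {g : E → ℝ} {g' : E → E} {m : ℝ}
    (hm : 0 < m) (hg : ∀ x, HasGradientAt g (g' x) x)
    (hsc : ∀ x z, x ≠ z → m * ‖z - x‖ ^ 2 ≤ ⟪z - x, g' z - g' x⟫) (x z : E) :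
    2 * m * (g x - g z) ≤ ‖g' x‖ ^ 2 := by
  have hneg : ∀ x, HasGradientAt (fun y => -g y) (-g' x) x := fun x => by
    have := (hg x).hasFDerivAt.neg
    rw [hasGradientAt_iff_hasFDerivAt, map_neg]
    exact this
  have h := le_quadratic_of_inner_gradient_sub_le_s3 (L := -m) hneg (fun x z hxz => by
    have := hsc x z hxz
    rw [← neg_sub', inner_neg_right]
    linarith) x z
  have hsq : 0 ≤ ‖g' x‖ ^ 2 + 2 * (m * ⟪g' x, z - x⟫) + m ^ 2 * ‖z - x‖ ^ 2 := by
    have h0 := sq_nonneg ‖g' x + m • (z - x)‖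
    rwa [norm_add_sq_real, real_inner_smul_right, norm_smul, mul_pow, Real.norm_eq_abs,
      sq_abs] at h0
  rw [inner_neg_left] at h
  nlinarith

/-- Decrease of a smooth function along a gradient step. -/
theorem gradient_step_le {g : E → ℝ} {g' : E → E} {L : ℝ}
    (hg : ∀ x, HasGradientAt g (g' x) x)
    (hL : ∀ x z, x ≠ z → ⟪z - x, g' z - g' x⟫ ≤ L * ‖z - x‖ ^ 2) (x : E) (c : ℝ) :
    g (x - c • g' x) ≤ g x - c * ‖g' x‖ ^ 2 + L / 2 * (c ^ 2 * ‖g' x‖ ^ 2) := by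
  have h := le_quadratic_of_inner_gradient_sub_le_s3 hg hL x (x - c • g' x)
  rw [sub_sub_cancel_left, inner_neg_right, real_inner_smul_right, real_inner_self_eq_norm_sq,
    norm_neg, norm_smul, mul_pow, Real.norm_eq_abs, sq_abs] at h
  linarith

/-- Contraction of the optimality gap along a gradient step. -/
theorem gradient_step_gap_le {g : E → ℝ} {g' : E → E} {m L c : ℝ} (hm : 0 < m)
    (hg : ∀ x, HasGradientAt g (g' x) x)
    (hsc : ∀ x z, x ≠ z → m * ‖z - x‖ ^ 2 ≤ ⟪z - x, g' z - g' x⟫)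
    (hL : ∀ x z, x ≠ z → ⟪z - x, g' z - g' x⟫ ≤ L * ‖z - x‖ ^ 2)
    (hc : 0 ≤ (1 - c * L / 2) * c) (x z : E) :
    g (x - c • g' x) - g z ≤ (1 - 2 * (1 - c * L / 2) * c * m) * (g x - g z) := by
  have h₁ := gradient_step_le hg hL x c
  have h₂ := mul_le_mul_of_nonneg_left
    (sub_le_norm_sq_gradient_of_strongly_monotone hm hg hsc x z) hc
  linarith

/-- Growth of a smooth function along the step `x ↦ x - (a / ‖∇g x‖²) • ∇g x`, `0 ≤ a`,
taken where the gradient is bounded below. -/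
theorem normalized_gradient_step_le {g : E → ℝ} {g' : E → E} {L a ε : ℝ} (hL0 : 0 ≤ L)
    (hε : 0 < ε) (ha : 0 ≤ a) (hg : ∀ x, HasGradientAt g (g' x) x)
    (hL : ∀ x z, x ≠ z → ⟪z - x, g' z - g' x⟫ ≤ L * ‖z - x‖ ^ 2) (x : E) (hx : ε ≤ ‖g' x‖) :
    g (x - (a / ‖g' x‖ ^ 2) • g' x) ≤ g x + L / 2 * (a ^ 2 / ε ^ 2) := by
  have hpos : 0 < ‖g' x‖ := hε.trans_le hx
  have h := gradient_step_le hg hL x (a / ‖g' x‖ ^ 2)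
  have h₁ : (a / ‖g' x‖ ^ 2) ^ 2 * ‖g' x‖ ^ 2 = a ^ 2 / ‖g' x‖ ^ 2 := by field_simp
  have h₂ : a ^ 2 / ‖g' x‖ ^ 2 ≤ a ^ 2 / ε ^ 2 := by gcongr
  rw [h₁, div_mul_cancel₀ _ (pow_pos hpos 2).ne'] at h
  have := mul_le_mul_of_nonneg_left h₂ (div_nonneg hL0 zero_le_two)
  linarith

end SmoothStronglyConvex

/-- A perturbed linear contraction stays below the corresponding geometric bound. -/
theorem le_geometric_of_le_mul_add {e : ℕ → ℝ} {ρ B : ℝ} (hρ : 0 ≤ ρ)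
    (h : ∀ k, e (k + 1) ≤ ρ * e k + (1 - ρ) * B) (k : ℕ) :
    e k ≤ ρ ^ k * e 0 + (1 - ρ ^ k) * B := by
  induction k with
  | zero => simp
  | succ k ih =>
    have := mul_le_mul_of_nonneg_left ih hρ
    rw [pow_succ]
    linarith [h k]

/-- Theorem 1 (Convergence guarantee of Algorithm 1). -/
theorem stmt_3 {n : ℕ} (hn : 1 ≤ n)
    (f : EuclideanSpace ℝ (Fin n) → ℝ → ℝ)
    (m M K₁ K₂ K₃ : ℝ) (hm : 0 < m) (hM : 0 < M)
    (hK₁ : 0 < K₁) (hK₂ : 0 < K₂) (hK₃ : 0 < K₃)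
    (hC2 : ContDiff ℝ 2 (Function.uncurry f))
    (hsc : ∀ t : ℝ, 0 ≤ t → ∀ x z : EuclideanSpace ℝ (Fin n), x ≠ z →
      m * ‖z - x‖ ^ 2 ≤ ⟪z - x, gradX f z t - gradX f x t⟫)
    (hlip : ∀ t : ℝ, 0 ≤ t → ∀ x z : EuclideanSpace ℝ (Fin n), x ≠ z →
      ⟪z - x, gradX f z t - gradX f x t⟫ ≤ M * ‖z - x‖ ^ 2)
    (hb1 : ∀ (x : EuclideanSpace ℝ (Fin n)) (t : ℝ), 0 ≤ t → |gradT f x t| ≤ K₁)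
    (hb2 : ∀ (x : EuclideanSpace ℝ (Fin n)) (t : ℝ), 0 ≤ t → ‖gradXT f x t‖ ≤ K₂)
    (hb3 : ∀ (x : EuclideanSpace ℝ (Fin n)) (t : ℝ), 0 ≤ t → |gradTT f x t| ≤ K₃)
    (xstar : ℝ → EuclideanSpace ℝ (Fin n))
    (hmin : ∀ t : ℝ, 0 ≤ t → ∀ y, f (xstar t) t ≤ f y t)
    (t0 δ ε α κ ψ γ μ E₁ : ℝ) (ht0 : 0 ≤ t0) (hδ : 0 < δ) (hε : 0 < ε)
    (hα : 0 < α) (hα2 : α ≤ 1 / (2 * M))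
    (hκ : κ = 1 - α * M / 2)
    (hψ : ψ = δ * (K₁ + (δ / 2) * K₃) + (K₂ ^ 2 * δ ^ 2 / (2 * m)) * ((M * δ / m) + 2))
    (hγ : γ = 2 * K₁ / δ + (M / (2 * ε ^ 2)) * K₁ ^ 2 + (1 / 2) * K₃ + (1 / ε) * (K₁ * K₂))
    (hμ : μ = K₁ + (δ / 2) * K₃)
    (hE₁ : E₁ = ψ / (4 * κ ^ 2 * α ^ 2 * m) + max (γ * δ ^ 2) (μ * δ) / (4 * κ ^ 2 * α ^ 2 * m ^ 2))
    (x xm : ℕ → EuclideanSpace ℝ (Fin n))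
    (hpred : ∀ k : ℕ, xm (k + 1) =
      if ε ≤ ‖gradX f (x k) (t0 + (k : ℝ) * δ)‖ then
        x k - (δ * |gradT f (x k) (t0 + (k : ℝ) * δ)| /
          ‖gradX f (x k) (t0 + (k : ℝ) * δ)‖ ^ 2) • gradX f (x k) (t0 + (k : ℝ) * δ)
      else x k)
    (hupd : ∀ k : ℕ, x (k + 1) = xm (k + 1) - α • gradX f (xm (k + 1)) (t0 + ((k : ℝ) + 1) * δ)) :
    ∀ k : ℕ, f (x k) (t0 + (k : ℝ) * δ) - f (xstar (t0 + (k : ℝ) * δ)) (t0 + (k : ℝ) * δ) ≤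
      (1 - 2 * κ * α * m) ^ k * (f (x 0) t0 - f (xstar t0) t0) +
        (1 - (1 - 2 * κ * α * m) ^ k) * E₁ := by
  have hmM : m ≤ M := by
    have : Nonempty (Fin n) := ⟨⟨0, hn⟩⟩
    obtain ⟨z, hz⟩ := exists_ne (0 : EuclideanSpace ℝ (Fin n))
    have hle := (hsc 0 le_rfl 0 z hz.symm).trans (hlip 0 le_rfl 0 z hz.symm)
    have hpos : 0 < ‖z - 0‖ ^ 2 := pow_pos (norm_pos_iff.2 (sub_ne_zero.2 hz)) 2
    exact le_of_mul_le_mul_right hle hpos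
  have hαM : α * M ≤ 1 / 2 := by
    rw [le_div_iff₀ (by positivity)] at hα2
    linarith
  have hκ0 : 0 < κ := by rw [hκ]; linarith
  have hs0 : 0 < 2 * κ * α * m := by positivity
  have hs1 : 2 * κ * α * m ≤ 1 := by
    have : 2 * κ * α * m ≤ 2 * κ * α * M := by gcongr
    rw [hκ] at this ⊢
    nlinarith [sq_nonneg (α * M - 1)]
  have hgrad : ∀ t y, HasGradientAt (fun y => f y t) (gradX f y t) y := fun t y => by
    have hdiff : Differentiable ℝ (Function.uncurry f) := hC2.differentiable (by norm_num)
    have : Differentiable ℝ (fun y => f y t) :=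
      hdiff.comp (differentiable_id.prodMk (differentiable_const t))
    exact (this y).hasGradientAt
  have htime : ∀ y s t, 0 ≤ s → 0 ≤ t → |f y t - f y s| ≤ K₁ * |t - s| := fun y s t hs ht => by
    have hdiff : Differentiable ℝ (Function.uncurry f) := hC2.differentiable (by norm_num)
    have : Differentiable ℝ (fun r => f y r) :=
      hdiff.comp ((differentiable_const y).prodMk differentiable_id)
    exact (convex_Ici (0 : ℝ)).norm_image_sub_le_of_norm_deriv_le (fun r _ => this r)
      (fun r hr => hb1 y r hr) hs ht
  have hpred_le : ∀ k : ℕ, f (xm (k + 1)) (t0 + k * δ) ≤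
      f (x k) (t0 + k * δ) + M / 2 * ((δ * K₁) ^ 2 / ε ^ 2) := fun k => by
    have htk : 0 ≤ t0 + k * δ := by positivity
    rw [hpred k]
    split_ifs with hk
    · refine (normalized_gradient_step_le hM.le hε (by positivity) (hgrad _) (hlip _ htk) (x k)
        hk).trans ?_
      have := hb1 (x k) _ htk
      gcongr
    · exact le_add_of_nonneg_right (by positivity)
  have hψ0 : 0 ≤ ψ := by rw [hψ]; positivity
  have hnoise : 2 * (K₁ * δ) + M / 2 * ((δ * K₁) ^ 2 / ε ^ 2) ≤ 2 * κ * α * m * E₁ := by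
    have hγδ : 2 * (K₁ * δ) + M / 2 * ((δ * K₁) ^ 2 / ε ^ 2) ≤ γ * δ ^ 2 := by
      have hsplit : γ * δ ^ 2 = 2 * (K₁ * δ) + M / 2 * ((δ * K₁) ^ 2 / ε ^ 2) +
          (1 / 2 * K₃ + 1 / ε * (K₁ * K₂)) * δ ^ 2 := by
        rw [hγ]
        field_simp
        ring
      rw [hsplit]
      exact le_add_of_nonneg_right (by positivity)
    have hsE : 2 * κ * α * m * E₁ =
        ψ / (2 * κ * α) + max (γ * δ ^ 2) (μ * δ) / (2 * κ * α * m) := by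
      rw [hE₁]
      field_simp
      ring
    have hmax0 : 0 ≤ max (γ * δ ^ 2) (μ * δ) :=
      le_max_of_le_right (by rw [hμ]; positivity)
    have hdiv : max (γ * δ ^ 2) (μ * δ) ≤ max (γ * δ ^ 2) (μ * δ) / (2 * κ * α * m) :=
      le_div_self hmax0 hs0 hs1
    have hψdiv : 0 ≤ ψ / (2 * κ * α) := by positivity
    linarith [le_max_left (γ * δ ^ 2) (μ * δ)]
  intro k
  have hgeom := le_geometric_of_le_mul_add
    (e := fun k : ℕ => f (x k) (t0 + k * δ) - f (xstar (t0 + k * δ)) (t0 + k * δ))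
    (ρ := 1 - 2 * κ * α * m) (B := E₁) (by linarith) (fun k => ?_) k
  · simpa using hgeom
  have htk : 0 ≤ t0 + k * δ := by positivity
  have htk' : 0 ≤ t0 + ((k : ℝ) + 1) * δ := by positivity
  have hstep : |t0 + ((k : ℝ) + 1) * δ - (t0 + k * δ)| = δ := by
    rw [show t0 + ((k : ℝ) + 1) * δ - (t0 + k * δ) = δ by ring, abs_of_pos hδ]
  have hcontr := gradient_step_gap_le hm (hgrad _) (hsc _ htk') (hlip _ htk') (c := α)
    (by rw [← hκ]; positivity) (xm (k + 1)) (xstar (t0 + ((k : ℝ) + 1) * δ))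
  rw [← hκ, ← hupd k] at hcontr
  have hdrift := htime (xm (k + 1)) _ _ htk htk'
  have hdrift' := htime (xstar (t0 + ((k : ℝ) + 1) * δ)) _ _ htk htk'
  rw [hstep, abs_le] at hdrift hdrift'
  have hopt := hmin _ htk (xstar (t0 + ((k : ℝ) + 1) * δ))
  have hgap : f (xm (k + 1)) (t0 + ((k : ℝ) + 1) * δ) -
      f (xstar (t0 + ((k : ℝ) + 1) * δ)) (t0 + ((k : ℝ) + 1) * δ) ≤
      f (x k) (t0 + k * δ) - f (xstar (t0 + k * δ)) (t0 + k * δ) +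
        (2 * (K₁ * δ) + M / 2 * ((δ * K₁) ^ 2 / ε ^ 2)) := by
    linarith [hpred_le k]
  have hscaled := mul_le_mul_of_nonneg_left hgap (sub_nonneg.2 hs1)
  have hnoise0 : 0 ≤ 2 * (K₁ * δ) + M / 2 * ((δ * K₁) ^ 2 / ε ^ 2) := by positivity
  have := mul_nonneg hs0.le hnoise0
  push_cast
  linarith
end

section
/- Under the strong convexity, Lipschitz-gradient, and smoothness-bound assumptions, let the sequence (x_k) be generated by Algorithm 1 with sampling period δ > 0, threshold ε > 0, and stepsize α satisfying 0 < α ≤ 1/(2M). Then the asymptotic tracking error satisfies limsup_{k→∞} (f(x_k, t_k) − f*(t_k)) ≤ E₁, where E₁ = ψ/(4κ²α²m) + max(γδ², μδ)/(4κ²α²m²), κ = 1 − αM/2, ψ = δ(K₁ + (δ/2)K₃) + (K₂²δ²/(2m))((Mδ/m) + 2), γ = 2K₁/δ + (M/(2ε²))K₁² + (1/2)K₃ + (1/ε)K₁K₂, and μ = K₁ + (δ/2)K₃. -/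
open scoped RealInnerProductSpace

/-- Descent lemma: a one-sided Lipschitz bound on the gradient gives a quadratic upper bound. -/
lemma le_add_inner_add_of_gradient_upper {E : Type*} [NormedAddCommGroup E]
    [InnerProductSpace ℝ E] [CompleteSpace E] {φ : E → ℝ} {φ' : E → E} {L : ℝ}
    (hφ : ∀ x, HasGradientAt φ (φ' x) x)
    (hL : ∀ x z, x ≠ z → ⟪z - x, φ' z - φ' x⟫ ≤ L * ‖z - x‖ ^ 2) (x y : E) :
    φ y ≤ φ x + ⟪φ' x, y - x⟫ + L / 2 * ‖y - x‖ ^ 2 := by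
  rcases eq_or_ne x y with rfl | hxy
  · simp
  set d := y - x with hd
  have hd0 : d ≠ 0 := sub_ne_zero.mpr hxy.symm
  let h : ℝ → ℝ := fun s => φ (x + s • d) - s * ⟪φ' x, d⟫ - L / 2 * ‖d‖ ^ 2 * s ^ 2
  have hder : ∀ s, HasDerivAt h (⟪φ' (x + s • d), d⟫ - ⟪φ' x, d⟫ - L * ‖d‖ ^ 2 * s) s := by
    intro s
    have hline : HasDerivAt (fun s : ℝ => x + s • d) d s := by
      simpa using ((hasDerivAt_id s).smul_const d).const_add x
    have h₁ : HasDerivAt (fun s : ℝ => φ (x + s • d)) ⟪φ' (x + s • d), d⟫ s := by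
      simpa [Function.comp_def] using (hφ (x + s • d)).hasFDerivAt.comp_hasDerivAt s hline
    have h₂ := (hasDerivAt_id s).mul_const ⟪φ' x, d⟫
    have h₃ := ((hasDerivAt_id s).pow 2).const_mul (L / 2 * ‖d‖ ^ 2)
    refine ((h₁.sub h₂).sub h₃).congr_deriv ?_
    simp
    ring
  have hanti : AntitoneOn h (Set.Icc 0 1) := by
    refine antitoneOn_of_deriv_nonpos (convex_Icc 0 1)
      (fun s _ => (hder s).continuousAt.continuousWithinAt)
      (fun s _ => (hder s).differentiableAt.differentiableWithinAt) fun s hs => ?_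
    rw [interior_Icc] at hs
    rw [(hder s).deriv]
    have hne : x ≠ x + s • d := by
      simp [hs.1.ne', hd0]
    have key := hL x (x + s • d) hne
    rw [add_sub_cancel_left, norm_smul, real_inner_smul_left, inner_sub_right,
      Real.norm_of_nonneg hs.1.le, real_inner_comm, real_inner_comm (φ' x)] at key
    have hs0 := hs.1
    by_contra! hcon
    nlinarith [mul_pos hs0 hcon]
  have h01 := hanti (Set.left_mem_Icc.mpr zero_le_one) (Set.right_mem_Icc.mpr zero_le_one)
    zero_le_one
  simp only [h, zero_smul, one_smul, add_zero] at h01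
  rw [show x + d = y by simp [hd]] at h01
  linarith

/-- Strong monotonicity of the gradient gives a quadratic lower bound. -/
lemma add_inner_add_le_of_gradient_lower {E : Type*} [NormedAddCommGroup E]
    [InnerProductSpace ℝ E] [CompleteSpace E] {φ : E → ℝ} {φ' : E → E} {m : ℝ}
    (hφ : ∀ x, HasGradientAt φ (φ' x) x)
    (hm : ∀ x z, x ≠ z → m * ‖z - x‖ ^ 2 ≤ ⟪z - x, φ' z - φ' x⟫) (x y : E) :
    φ x + ⟪φ' x, y - x⟫ + m / 2 * ‖y - x‖ ^ 2 ≤ φ y := by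
  have hneg : ∀ x, HasGradientAt (fun y => -φ y) (-φ' x) x := fun x => by
    rw [hasGradientAt_iff_hasFDerivAt, map_neg]
    exact (hφ x).hasFDerivAt.fun_neg
  have := le_add_inner_add_of_gradient_upper (L := -m) hneg (fun x z hxz => by
    have := hm x z hxz
    rw [show -φ' z - -φ' x = -(φ' z - φ' x) by abel, inner_neg_right]
    linarith) x y
  rw [inner_neg_left] at this
  linarith

/-- Polyak–Łojasiewicz inequality for functions with strongly monotone gradient. -/
lemma two_mul_sub_le_norm_gradient_sq {E : Type*} [NormedAddCommGroup E]
    [InnerProductSpace ℝ E] [CompleteSpace E] {φ : E → ℝ} {φ' : E → E} {m : ℝ} (hm0 : 0 < m)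
    (hφ : ∀ x, HasGradientAt φ (φ' x) x)
    (hm : ∀ x z, x ≠ z → m * ‖z - x‖ ^ 2 ≤ ⟪z - x, φ' z - φ' x⟫) (x y : E) :
    2 * m * (φ x - φ y) ≤ ‖φ' x‖ ^ 2 := by
  have h₁ := add_inner_add_le_of_gradient_lower hφ hm x y
  have h₂ := norm_add_sq_real (φ' x) (m • (y - x))
  rw [norm_smul, real_inner_smul_right, Real.norm_of_nonneg hm0.le] at h₂
  nlinarith [sq_nonneg ‖φ' x + m • (y - x)‖]

/-- Decrease of a function along a gradient step with stepsize `a`. -/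
lemma gradient_step_le_s4 {E : Type*} [NormedAddCommGroup E]
    [InnerProductSpace ℝ E] [CompleteSpace E] {φ : E → ℝ} {φ' : E → E} {L : ℝ}
    (hφ : ∀ x, HasGradientAt φ (φ' x) x)
    (hL : ∀ x z, x ≠ z → ⟪z - x, φ' z - φ' x⟫ ≤ L * ‖z - x‖ ^ 2) (x : E) (a : ℝ) :
    φ (x - a • φ' x) ≤ φ x - a * (1 - a * L / 2) * ‖φ' x‖ ^ 2 := by
  have h := le_add_inner_add_of_gradient_upper hφ hL x (x - a • φ' x)
  rw [show x - a • φ' x - x = -(a • φ' x) by abel, inner_neg_right, norm_neg, norm_smul,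
    real_inner_smul_right, real_inner_self_eq_norm_sq, mul_pow, Real.norm_eq_abs, sq_abs] at h
  linarith

/-- Closed-form bound for a perturbed linear contraction. -/
lemma le_pow_mul_add_div_of_le_one_sub_mul {e : ℕ → ℝ} {c Q : ℝ} (hc : 0 < c) (hc1 : c ≤ 1)
    (hQ : 0 ≤ Q) (he : ∀ k, e (k + 1) ≤ (1 - c) * (e k + Q)) (k : ℕ) :
    e k ≤ (1 - c) ^ k * e 0 + Q / c := by
  induction k with
  | zero => simpa using div_nonneg hQ hc.le
  | succ k ih =>
    have h₁ := mul_le_mul_of_nonneg_left (add_le_add_left ih Q) (sub_nonneg.mpr hc1)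
    have h₂ : (1 - c) * (Q / c + Q) = Q / c - c * Q := by
      field_simp
      ring
    have h₃ := mul_nonneg hc.le hQ
    calc e (k + 1) ≤ _ := he k
      _ ≤ _ := h₁
      _ = (1 - c) ^ (k + 1) * e 0 + (1 - c) * (Q / c + Q) := by ring
      _ ≤ _ := by rw [h₂]; linarith

/-- Remark 1: ultimate tracking bound of Algorithm 1 (limsup ≤ E₁). -/
theorem stmt_4 {n : ℕ} (hn : 1 ≤ n)
    (f : EuclideanSpace ℝ (Fin n) → ℝ → ℝ)
    (m M K₁ K₂ K₃ : ℝ) (hm : 0 < m) (hM : 0 < M)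
    (hK₁ : 0 < K₁) (hK₂ : 0 < K₂) (hK₃ : 0 < K₃)
    (hC2 : ContDiff ℝ 2 (Function.uncurry f))
    (hsc : ∀ t : ℝ, 0 ≤ t → ∀ x z : EuclideanSpace ℝ (Fin n), x ≠ z →
      m * ‖z - x‖ ^ 2 ≤ ⟪z - x, gradX f z t - gradX f x t⟫)
    (hlip : ∀ t : ℝ, 0 ≤ t → ∀ x z : EuclideanSpace ℝ (Fin n), x ≠ z →
      ⟪z - x, gradX f z t - gradX f x t⟫ ≤ M * ‖z - x‖ ^ 2)
    (hb1 : ∀ (x : EuclideanSpace ℝ (Fin n)) (t : ℝ), 0 ≤ t → |gradT f x t| ≤ K₁)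
    (hb2 : ∀ (x : EuclideanSpace ℝ (Fin n)) (t : ℝ), 0 ≤ t → ‖gradXT f x t‖ ≤ K₂)
    (hb3 : ∀ (x : EuclideanSpace ℝ (Fin n)) (t : ℝ), 0 ≤ t → |gradTT f x t| ≤ K₃)
    (xstar : ℝ → EuclideanSpace ℝ (Fin n))
    (hmin : ∀ t : ℝ, 0 ≤ t → ∀ y, f (xstar t) t ≤ f y t)
    (t0 δ ε α κ ψ γ μ E₁ : ℝ) (ht0 : 0 ≤ t0) (hδ : 0 < δ) (hε : 0 < ε)
    (hα : 0 < α) (hα2 : α ≤ 1 / (2 * M))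
    (hκ : κ = 1 - α * M / 2)
    (hψ : ψ = δ * (K₁ + (δ / 2) * K₃) + (K₂ ^ 2 * δ ^ 2 / (2 * m)) * ((M * δ / m) + 2))
    (hγ : γ = 2 * K₁ / δ + (M / (2 * ε ^ 2)) * K₁ ^ 2 + (1 / 2) * K₃ + (1 / ε) * (K₁ * K₂))
    (hμ : μ = K₁ + (δ / 2) * K₃)
    (hE₁ : E₁ = ψ / (4 * κ ^ 2 * α ^ 2 * m) + max (γ * δ ^ 2) (μ * δ) / (4 * κ ^ 2 * α ^ 2 * m ^ 2))
    (x xm : ℕ → EuclideanSpace ℝ (Fin n))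
    (hpred : ∀ k : ℕ, xm (k + 1) =
      if ε ≤ ‖gradX f (x k) (t0 + (k : ℝ) * δ)‖ then
        x k - (δ * |gradT f (x k) (t0 + (k : ℝ) * δ)| /
          ‖gradX f (x k) (t0 + (k : ℝ) * δ)‖ ^ 2) • gradX f (x k) (t0 + (k : ℝ) * δ)
      else x k)
    (hupd : ∀ k : ℕ, x (k + 1) = xm (k + 1) - α • gradX f (xm (k + 1)) (t0 + ((k : ℝ) + 1) * δ)) :
    Filter.limsup (fun k : ℕ =>
        f (x k) (t0 + (k : ℝ) * δ) - f (xstar (t0 + (k : ℝ) * δ)) (t0 + (k : ℝ) * δ))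
      Filter.atTop ≤ E₁ := by
  have hdiff := hC2.differentiable two_ne_zero
  have hgrad : ∀ t x, HasGradientAt (fun y => f y t) (gradX f x t) x := fun t x =>
    DifferentiableAt.hasGradientAt
      ((hdiff (x, t)).comp x (f := fun y => (y, t)) (by fun_prop))
  have htime : ∀ x s t, 0 ≤ s → 0 ≤ t → |f x t - f x s| ≤ K₁ * |t - s| := fun x s t hs ht =>
    (convex_Ici (0 : ℝ)).norm_image_sub_le_of_norm_deriv_le (f := fun r => f x r)
      (fun r _ => (hdiff (x, r)).comp r (f := fun r => (x, r)) (by fun_prop))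
      (fun r hr => hb1 x r hr) hs ht
  have hmM : m ≤ M := by
    obtain ⟨v, hv⟩ : ∃ v : EuclideanSpace ℝ (Fin n), v ≠ 0 :=
      ⟨EuclideanSpace.single ⟨0, hn⟩ 1, by simp⟩
    have h := (hsc 0 le_rfl 0 v hv.symm).trans (hlip 0 le_rfl 0 v hv.symm)
    rw [sub_zero] at h
    exact le_of_mul_le_mul_right h (by positivity)
  have hαM : α * M ≤ 1 / 2 := by
    rw [le_div_iff₀ (by positivity)] at hα2
    linarith
  have hαM0 : 0 < α * M := mul_pos hα hM
  have hκ0 : 0 < κ := by rw [hκ]; linarith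
  have hκ1 : κ < 1 := by rw [hκ]; linarith
  set c := 2 * κ * α * m with hc
  have hc0 : 0 < c := by positivity
  have hc1 : c < 1 := by
    have h₁ : α * m ≤ 1 / 2 := (mul_le_mul_of_nonneg_left hmM hα.le).trans hαM
    have h₂ := mul_le_mul_of_nonneg_left h₁ hκ0.le
    rw [hc]
    linarith
  set T : ℕ → ℝ := fun k => t0 + (k : ℝ) * δ with hT
  have hT0 : ∀ k, 0 ≤ T k := fun k => by positivity
  have hTs : ∀ k : ℕ, t0 + ((k : ℝ) + 1) * δ = T (k + 1) := fun k => by simp [hT]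
  have hTd : ∀ k, |T (k + 1) - T k| = δ := fun k => by
    rw [← hTs, show t0 + ((k : ℝ) + 1) * δ - T k = δ by simp only [hT]; ring, abs_of_pos hδ]
  set Q := 2 * K₁ * δ + M / 2 * (δ ^ 2 * K₁ ^ 2 / ε ^ 2) with hQ
  have hQ0 : 0 < Q := by positivity
  have hpredict : ∀ k, f (xm (k + 1)) (T k) ≤
      f (x k) (T k) + M / 2 * (δ ^ 2 * K₁ ^ 2 / ε ^ 2) := by
    intro k
    rw [hpred k]
    split_ifs with hg
    · have hstep := gradient_step_le_s4 (hgrad (T k)) (hlip (T k) (hT0 k)) (x k)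
        (δ * |gradT f (x k) (T k)| / ‖gradX f (x k) (T k)‖ ^ 2)
      change ε ≤ ‖gradX f (x k) (T k)‖ at hg
      have hg0 : 0 < ‖gradX f (x k) (T k)‖ := hε.trans_le hg
      have hd := hb1 (x k) (T k) (hT0 k)
      have hsq : δ ^ 2 * |gradT f (x k) (T k)| ^ 2 / ‖gradX f (x k) (T k)‖ ^ 2 ≤
          δ ^ 2 * K₁ ^ 2 / ε ^ 2 := by gcongr
      refine hstep.trans ?_
      generalize ‖gradX f (x k) (T k)‖ = G at *
      generalize hD : |gradT f (x k) (T k)| = D at *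
      have hD0 : 0 ≤ D := hD ▸ abs_nonneg _
      have hexp : δ * D / G ^ 2 * (1 - δ * D / G ^ 2 * M / 2) * G ^ 2 =
          δ * D - M / 2 * (δ ^ 2 * D ^ 2 / G ^ 2) := by
        field_simp
      rw [hexp]
      have h₁ := mul_nonneg hδ.le hD0
      have h₂ := mul_le_mul_of_nonneg_left hsq (half_pos hM).le
      linarith
    · exact le_add_of_nonneg_right (by positivity)
  set e : ℕ → ℝ := fun k => f (x k) (T k) - f (xstar (T k)) (T k) with he
  have he0 : ∀ k, 0 ≤ e k := fun k => sub_nonneg.mpr (hmin _ (hT0 k) _)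
  have hrec : ∀ k, e (k + 1) ≤ (1 - c) * (e k + Q) := by
    intro k
    set S := T (k + 1) with hS
    have hcorr := gradient_step_le_s4 (hgrad S) (hlip S (hT0 _)) (xm (k + 1)) α
    rw [← hκ] at hcorr
    have hPL := two_mul_sub_le_norm_gradient_sq hm (hgrad S) (hsc S (hT0 _)) (xm (k + 1)) (xstar S)
    have hxk : x (k + 1) = xm (k + 1) - α • gradX f (xm (k + 1)) S := by rw [hupd k, hTs]
    have h₁ := htime (xm (k + 1)) (T k) S (hT0 _) (hT0 _)
    have h₂ := htime (xstar S) (T k) S (hT0 _) (hT0 _)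
    rw [hTd, abs_le] at h₁ h₂
    have h₃ := hmin (T k) (hT0 k) (xstar S)
    have h₄ := hpredict k
    have h₅ : f (xm (k + 1)) S - f (xstar S) S ≤ e k + Q := by
      simp only [he, hQ]
      linarith [h₁.2, h₂.1]
    have h₆ := mul_le_mul_of_nonneg_left hPL (mul_pos hα hκ0).le
    have h₇ := mul_le_mul_of_nonneg_left h₅ (sub_nonneg.mpr hc1.le)
    refine le_trans ?_ h₇
    simp only [he, ← hS, hxk, hc]
    linarith
  have hE : Q / c < E₁ := by
    have hψ0 : 0 ≤ ψ := by rw [hψ]; positivity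
    have hQγ : Q ≤ γ * δ ^ 2 := by
      have h : γ * δ ^ 2 = Q + (1 / 2 * K₃ + 1 / ε * (K₁ * K₂)) * δ ^ 2 := by
        rw [hγ, hQ]
        field_simp
        ring
      rw [h]
      exact le_add_of_nonneg_right (by positivity)
    have hc2 : 4 * κ ^ 2 * α ^ 2 * m ^ 2 = c ^ 2 := by rw [hc]; ring
    rw [hE₁, hc2]
    calc Q / c < Q / c ^ 2 := div_lt_div_of_pos_left hQ0 (by positivity) (by nlinarith)
      _ ≤ max (γ * δ ^ 2) (μ * δ) / c ^ 2 := by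
        gcongr
        exact hQγ.trans (le_max_left _ _)
      _ ≤ _ := le_add_of_nonneg_left (by positivity)
  have hlim : Filter.Tendsto (fun k : ℕ => (1 - c) ^ k * e 0 + Q / c) Filter.atTop
      (nhds (Q / c)) := by
    simpa using ((tendsto_pow_atTop_nhds_zero_of_lt_one (sub_nonneg.mpr hc1.le)
      (sub_lt_self 1 hc0)).mul_const (e 0)).add_const (Q / c)
  refine Filter.limsup_le_of_le
    (Filter.IsBoundedUnder.isCoboundedUnder_le (Filter.isBoundedUnder_of ⟨0, he0⟩)) ?_
  filter_upwards [hlim.eventually_lt_const hE] with k hk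
  exact (le_pow_mul_add_div_of_le_one_sub_mul hc0 hc1.le hQ0.le hrec k).trans hk.le
end

section
/- Under the Lipschitz-gradient and smoothness-bound assumptions, fix x_k ∈ ℝⁿ, t_k ≥ δ > 0, ε > 0, with 0 < δ ≤ 2ε²/((K₁ + (δ/2)K₃)M + 2εK₂). Define the predicted point p: if ‖∇ₓf(x_k,t_k)‖ ≥ ε, set p = x_k − (|f(x_k, t_k) − f(x_k, t_k − δ)| / ‖∇ₓf(x_k,t_k)‖²) ∇ₓf(x_k,t_k); otherwise set p = x_k. Then f(p, t_k+δ) ≤ f(x_k, t_k+δ); that is, the prediction step of Algorithm 2 yields a function value at time t_{k+1} = t_k + δ no larger than that of the plain gradient-descent prediction p = x_k. -/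
open scoped RealInnerProductSpace

/-- The descent lemma from a one-sided Lipschitz bound on the gradient. -/
theorem descent_of_inner_gradient_le {E : Type*} [NormedAddCommGroup E] [InnerProductSpace ℝ E]
    [CompleteSpace E] {φ : E → ℝ} {M : ℝ} (hφ : Differentiable ℝ φ)
    (hlip : ∀ x z : E, x ≠ z →
      ⟪z - x, gradient φ z - gradient φ x⟫ ≤ M * ‖z - x‖ ^ 2) (x v : E) :
    φ (x + v) ≤ φ x + ⟪gradient φ x, v⟫ + M / 2 * ‖v‖ ^ 2 := by
  rcases eq_or_ne v 0 with rfl | hv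
  · simp
  have hd : ∀ s : ℝ, HasDerivAt
      (fun s : ℝ => φ (x + s • v) - s * ⟪gradient φ x, v⟫ - M / 2 * ‖v‖ ^ 2 * s ^ 2)
      (⟪gradient φ (x + s • v), v⟫ - ⟪gradient φ x, v⟫ - M * ‖v‖ ^ 2 * s) s := by
    intro s
    have h1 : HasDerivAt (fun s : ℝ => x + s • v) v s := by
      simpa using ((hasDerivAt_id s).smul_const v).const_add x
    have h2 := (hφ (x + s • v)).hasGradientAt.hasFDerivAt.comp_hasDerivAt s h1
    simp only [InnerProductSpace.toDual_apply_apply] at h2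
    have h3 := (h2.sub ((hasDerivAt_id s).mul_const ⟪gradient φ x, v⟫)).sub
      ((hasDerivAt_pow 2 s).const_mul (M / 2 * ‖v‖ ^ 2))
    refine h3.congr_deriv ?_
    norm_num
    ring
  have hanti : AntitoneOn
      (fun s : ℝ => φ (x + s • v) - s * ⟪gradient φ x, v⟫ - M / 2 * ‖v‖ ^ 2 * s ^ 2)
      (Set.Icc 0 1) := by
    refine antitoneOn_of_deriv_nonpos (convex_Icc 0 1)
      (fun s _ => (hd s).continuousAt.continuousWithinAt)
      (fun s _ => (hd s).differentiableAt.differentiableWithinAt) fun s hs => ?_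
    rw [interior_Icc] at hs
    rw [(hd s).deriv]
    have hs0 : 0 < s := hs.1
    have h := hlip x (x + s • v) (by simp [hs0.ne', hv])
    rw [add_sub_cancel_left, real_inner_smul_left, norm_smul, Real.norm_of_nonneg hs0.le,
      inner_sub_right, real_inner_comm, real_inner_comm (gradient φ x) v] at h
    have h' : s * (⟪gradient φ (x + s • v), v⟫ - ⟪gradient φ x, v⟫ - M * ‖v‖ ^ 2 * s) ≤ 0 := by
      linarith
    exact nonpos_of_mul_nonpos_right h' hs0
  have h := hanti (Set.left_mem_Icc.2 zero_le_one) (Set.right_mem_Icc.2 zero_le_one) zero_le_one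
  simp only [one_smul, zero_smul, add_zero] at h
  linarith

/-- A bound on the mixed derivative bounds mixed second differences. -/
theorem abs_mixed_difference_le {n : ℕ} {f : EuclideanSpace ℝ (Fin n) → ℝ → ℝ} {K a b : ℝ}
    (hf : ContDiff ℝ 2 (Function.uncurry f)) (hab : a ≤ b)
    (hK : ∀ x, ∀ t ∈ Set.Icc a b, ‖gradXT f x t‖ ≤ K) (x y : EuclideanSpace ℝ (Fin n)) :
    |(f y b - f x b) - (f y a - f x a)| ≤ K * ‖y - x‖ * (b - a) := by
  have hdt : ∀ z t, HasDerivAt (f z) (fderiv ℝ (Function.uncurry f) (z, t) (0, 1)) t := by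
    intro z t
    exact ((hf.differentiable (by norm_num)) (z, t)).hasFDerivAt.comp_hasDerivAt t
      ((hasDerivAt_const t z).prodMk (hasDerivAt_id t))
  have hdiff : ∀ t, Differentiable ℝ (fun z => deriv (fun s => f z s) t) := by
    intro t
    have h1 : (fun z => deriv (fun s => f z s) t) =
        fun z => fderiv ℝ (Function.uncurry f) (z, t) (0, 1) :=
      funext fun z => (hdt z t).deriv
    rw [h1]
    have h2 : Differentiable ℝ (fderiv ℝ (Function.uncurry f)) :=
      (hf.fderiv_right (m := 1) (by norm_num)).differentiable (by norm_num)
    have h3 : Differentiable ℝ (fun z : EuclideanSpace ℝ (Fin n) => (z, t)) := by fun_prop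
    exact (h2.comp h3).clm_apply (differentiable_const _)
  have hbound : ∀ t ∈ Set.Icc a b, ‖deriv (f y) t - deriv (f x) t‖ ≤ K * ‖y - x‖ := by
    intro t ht
    refine Convex.norm_image_sub_le_of_norm_fderiv_le (𝕜 := ℝ)
      (f := fun z => deriv (fun s => f z s) t) (s := Set.univ)
      (fun z _ => hdiff t z) (fun z _ => ?_) convex_univ (Set.mem_univ x) (Set.mem_univ y)
    have h := hK z t ht
    rwa [gradXT, gradient, LinearIsometryEquiv.norm_map] at h
  have h := Convex.norm_image_sub_le_of_norm_hasDerivWithin_le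
    (f := fun t => f y t - f x t) (f' := fun t => deriv (f y) t - deriv (f x) t)
    (fun t _ => ((hdt y t).differentiableAt.hasDerivAt.sub
      (hdt x t).differentiableAt.hasDerivAt).hasDerivWithinAt)
    hbound (convex_Icc a b) (Set.left_mem_Icc.2 hab) (Set.right_mem_Icc.2 hab)
  rwa [Real.norm_eq_abs, Real.norm_of_nonneg (sub_nonneg.2 hab)] at h

/-- Remark 3: for `0 < δ ≤ 2ε²/((K₁ + (δ/2)K₃)M + 2εK₂)`, the finite-difference
prediction step of Algorithm 2 yields `f(p, t_k+δ) ≤ f(x_k, t_k+δ)`. -/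
theorem stmt_7 {n : ℕ} (hn : 1 ≤ n)
    (f : EuclideanSpace ℝ (Fin n) → ℝ → ℝ)
    (M K₁ K₂ K₃ : ℝ) (hM : 0 < M)
    (hK₁ : 0 < K₁) (hK₂ : 0 < K₂) (hK₃ : 0 < K₃)
    (hC2 : ContDiff ℝ 2 (Function.uncurry f))
    (hlip : ∀ t : ℝ, 0 ≤ t → ∀ x z : EuclideanSpace ℝ (Fin n), x ≠ z →
      ⟪z - x, gradX f z t - gradX f x t⟫ ≤ M * ‖z - x‖ ^ 2)
    (hb1 : ∀ (x : EuclideanSpace ℝ (Fin n)) (t : ℝ), 0 ≤ t → |gradT f x t| ≤ K₁)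
    (hb2 : ∀ (x : EuclideanSpace ℝ (Fin n)) (t : ℝ), 0 ≤ t → ‖gradXT f x t‖ ≤ K₂)
    (hb3 : ∀ (x : EuclideanSpace ℝ (Fin n)) (t : ℝ), 0 ≤ t → |gradTT f x t| ≤ K₃)
    (xk : EuclideanSpace ℝ (Fin n)) (tk δ ε : ℝ) (hδ : 0 < δ) (htk : δ ≤ tk)
    (hε : 0 < ε)
    (hδ2 : δ ≤ 2 * ε ^ 2 / ((K₁ + (δ / 2) * K₃) * M + 2 * ε * K₂))
    (p : EuclideanSpace ℝ (Fin n))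
    (hp : p = if ε ≤ ‖gradX f xk tk‖ then
        xk - (|f xk tk - f xk (tk - δ)| / ‖gradX f xk tk‖ ^ 2) • gradX f xk tk
      else xk) :
    f p (tk + δ) ≤ f xk (tk + δ) := by
  split_ifs at hp with hG
  swap
  · rw [hp]
  have hG0 : 0 < ‖gradX f xk tk‖ := hε.trans_le hG
  have htk0 : 0 ≤ tk := hδ.le.trans htk
  have hf1 : Differentiable ℝ (Function.uncurry f) := hC2.differentiable (by norm_num)
  have hfx : Differentiable ℝ (fun y => f y tk) :=
    hf1.comp (g := Function.uncurry f) (f := fun y => (y, tk)) (by fun_prop)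
  have hft : Differentiable ℝ (f xk) :=
    hf1.comp (g := Function.uncurry f) (f := fun t => (xk, t)) (by fun_prop)
  have hD : |f xk tk - f xk (tk - δ)| ≤ K₁ * δ := by
    have h := Convex.norm_image_sub_le_of_norm_deriv_le (f := f xk) (C := K₁)
      (fun t _ => hft t) (fun t ht => hb1 xk t ((sub_nonneg.2 htk).trans ht.1))
      (convex_Icc (tk - δ) tk) (Set.left_mem_Icc.2 (by linarith))
      (Set.right_mem_Icc.2 (by linarith))
    rwa [sub_sub_cancel, Real.norm_of_nonneg hδ.le, Real.norm_eq_abs] at h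
  have hD0 : 0 ≤ |f xk tk - f xk (tk - δ)| := abs_nonneg _
  generalize |f xk tk - f xk (tk - δ)| = D at hD hD0 hp
  have hdesc := descent_of_inner_gradient_le hfx (hlip tk htk0) xk
    (-((D / ‖gradX f xk tk‖ ^ 2) • gradX f xk tk))
  have hmix := (abs_le.1 (abs_mixed_difference_le hC2 (show tk ≤ tk + δ by linarith)
    (fun x t ht => hb2 x t (htk0.trans ht.1)) xk p)).2
  change _ ≤ _ + ⟪gradX f xk tk, _⟫ + _ at hdesc
  rw [← sub_eq_add_neg, ← hp, inner_neg_right, real_inner_smul_right,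
    real_inner_self_eq_norm_sq, norm_neg] at hdesc
  have hpx : ‖p - xk‖ = D / ‖gradX f xk tk‖ := by
    rw [hp, sub_sub_cancel_left, norm_neg, norm_smul, Real.norm_of_nonneg (by positivity)]
    field_simp
  have hv : ‖(D / ‖gradX f xk tk‖ ^ 2) • gradX f xk tk‖ = D / ‖gradX f xk tk‖ := by
    rw [← hpx, hp, sub_sub_cancel_left, norm_neg]
  rw [hv, div_mul_cancel₀ _ (by positivity)] at hdesc
  rw [hpx, add_sub_cancel_left] at hmix
  rw [le_div_iff₀ (by positivity)] at hδ2
  generalize ‖gradX f xk tk‖ = G at hG hG0 hdesc hmix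
  have hstep : M * D + 2 * (K₂ * δ) * G ≤ 2 * G ^ 2 := by
    have h1 : M * D ≤ M * (K₁ * δ) := by gcongr
    have h2 : 0 ≤ δ * (δ / 2 * K₃ * M) := by positivity
    have h3 : M * D + 2 * (K₂ * δ) * ε ≤ 2 * ε ^ 2 := by linarith
    have h4 : K₂ * δ ≤ ε := by
      have : 0 ≤ M * D := by positivity
      have : K₂ * δ * ε ≤ ε * ε := by linarith
      exact le_of_mul_le_mul_right this hε
    nlinarith [mul_nonneg (sub_nonneg.2 hG) (sub_nonneg.2 h4), sq_nonneg (G - ε)]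
  have hfin : M / 2 * (D / G) ^ 2 + K₂ * (D / G) * δ ≤ D := by
    have h : M / 2 * (D / G) ^ 2 + K₂ * (D / G) * δ =
        D * (M * D + 2 * (K₂ * δ) * G) / (2 * G ^ 2) := by
      field_simp
    rw [h, div_le_iff₀ (by positivity)]
    gcongr
  linarith
end
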